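/- Let U be a compact metric space, t > 0, α ≥ 0, and let c : ℝ^d × U → ℝ be a continuous function with |c(x,ζ)| ≤ M for all (x,ζ) and |c(x,ζ) - c(y,ζ)| ≤ L |x - y| for all x, y ∈ ℝ^d and ζ ∈ U. Let x_n : [0,t] → ℝ^d be measurable functions and x : [0,t] → ℝ^d a continuous function such that x_n(s) → x(s) for Lebesgue-almost every s ∈ [0,t]. Let ν_n and ν be Borel probability measures on [0,t] × U such that the first marginal of each ν_n and of ν equals the normalized Lebesgue measure on [0,t], and suppose ν_n → ν weakly. Then ∫_{[0,t]×U} e^{-α s} c(x_n(s), ζ) dν_n(s,ζ) → ∫_{[0,t]×U} e^{-α s} c(x(s), ζ) dν(s,ζ) as n → ∞. -/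

import Mathlib

open MeasureTheory Filter

/-- Key deterministic convergence lemma for relaxed controls: if `xₙ → x` a.e. on `[0,t]`,
`νₙ → ν` weakly with first marginals equal to normalized Lebesgue measure on `[0,t]`,
and `c` is bounded, continuous and Lipschitz in its first argument uniformly in the control,
then `∫ e^{-αs} c(xₙ(s), ζ) dνₙ → ∫ e^{-αs} c(x(s), ζ) dν`. -/
theorem relaxed_control_cost_convergence {d : ℕ} {U : Type*} [MetricSpace U]
    [CompactSpace U] [MeasurableSpace U] [BorelSpace U]
    (t α M L : ℝ) (ht : 0 < t) (hα : 0 ≤ α)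
    (c : EuclideanSpace ℝ (Fin d) × U → ℝ) (hc : Continuous c)
    (hM : ∀ p, |c p| ≤ M)
    (hL : ∀ (x y : EuclideanSpace ℝ (Fin d)) (ζ : U), |c (x, ζ) - c (y, ζ)| ≤ L * ‖x - y‖)
    (xn : ℕ → ℝ → EuclideanSpace ℝ (Fin d)) (x : ℝ → EuclideanSpace ℝ (Fin d))
    (hxn : ∀ n, Measurable (xn n)) (hx : ContinuousOn x (Set.Icc 0 t))
    (hae : ∀ᵐ s ∂(MeasureTheory.volume.restrict (Set.Icc (0 : ℝ) t)),
      Filter.Tendsto (fun n => xn n s) Filter.atTop (nhds (x s)))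
    (ν : ℕ → MeasureTheory.Measure (ℝ × U)) (νl : MeasureTheory.Measure (ℝ × U))
    (hνprob : ∀ n, MeasureTheory.IsProbabilityMeasure (ν n))
    (hνlprob : MeasureTheory.IsProbabilityMeasure νl)
    (hmarg : ∀ n, (ν n).map Prod.fst =
      (ENNReal.ofReal t)⁻¹ • MeasureTheory.volume.restrict (Set.Icc (0 : ℝ) t))
    (hmargl : νl.map Prod.fst =
      (ENNReal.ofReal t)⁻¹ • MeasureTheory.volume.restrict (Set.Icc (0 : ℝ) t))
    (hweak : ∀ g : BoundedContinuousFunction (ℝ × U) ℝ,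
      Filter.Tendsto (fun n => ∫ p, g p ∂(ν n)) Filter.atTop (nhds (∫ p, g p ∂νl))) :
    Filter.Tendsto
      (fun n => ∫ p : ℝ × U, Real.exp (-α * p.1) * c (xn n p.1, p.2) ∂(ν n))
      Filter.atTop
      (nhds (∫ p : ℝ × U, Real.exp (-α * p.1) * c (x p.1, p.2) ∂νl)) := by
  set μ : Measure ℝ := (ENNReal.ofReal t)⁻¹ • volume.restrict (Set.Icc (0 : ℝ) t) with hμ
  have hμprob : IsProbabilityMeasure μ := by
    rw [← hmargl]
    exact Measure.isProbabilityMeasure_map measurable_fst.aemeasurable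
  have hM0 : 0 ≤ M := by
    have : Nonempty (ℝ × U) := by
      by_contra hne
      rw [not_nonempty_iff] at hne
      have h1 := hνlprob.measure_univ
      rw [Set.univ_eq_empty_iff.mpr hne] at h1
      simp at h1
    obtain ⟨p⟩ := this
    exact (abs_nonneg _).trans (hM (0, p.2))
  let y : ℝ → EuclideanSpace ℝ (Fin d) := Set.IccExtend ht.le ((Set.Icc 0 t).domRestrict x)
  have hy : Continuous y := (continuousOn_iff_continuous_domRestrict.mp hx).Icc_extend'
  have hyx : ∀ s ∈ Set.Icc (0 : ℝ) t, y s = x s := fun s hs => by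
    simp [y, Set.IccExtend_of_mem ht.le _ hs]
  have hμIcc : ∀ᵐ s ∂μ, s ∈ Set.Icc (0 : ℝ) t :=
    Measure.ae_smul_measure (ae_restrict_mem measurableSet_Icc) _
  have hνIcc : ∀ n, ∀ᵐ p ∂(ν n), p.1 ∈ Set.Icc (0 : ℝ) t := fun n =>
    ae_of_ae_map measurable_fst.aemeasurable (by rw [hmarg n]; exact hμIcc)
  have hνlIcc : ∀ᵐ p ∂νl, p.1 ∈ Set.Icc (0 : ℝ) t :=
    ae_of_ae_map measurable_fst.aemeasurable (by rw [hmargl]; exact hμIcc)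
  have hexp : ∀ s : ℝ, 0 ≤ s → |Real.exp (-α * s)| ≤ 1 := fun s hs => by
    rw [abs_of_pos (Real.exp_pos _)]
    exact Real.exp_le_one_iff.mpr (by nlinarith)
  let g : BoundedContinuousFunction (ℝ × U) ℝ :=
    BoundedContinuousFunction.ofNormedAddCommGroup
      (fun p => Real.exp (-α * max 0 p.1) * c (y p.1, p.2)) (by fun_prop) M (fun p => by
        rw [Real.norm_eq_abs, abs_mul]
        calc _ ≤ 1 * M := mul_le_mul (hexp _ (le_max_left _ _)) (hM _) (abs_nonneg _) zero_le_one
          _ = M := one_mul M)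
  have hg : ∀ p, g p = Real.exp (-α * max 0 p.1) * c (y p.1, p.2) := fun p => rfl
  have hlim : ∫ p, g p ∂νl = ∫ p : ℝ × U, Real.exp (-α * p.1) * c (x p.1, p.2) ∂νl := by
    apply integral_congr_ae
    filter_upwards [hνlIcc] with p hp
    rw [hg, max_eq_right hp.1, hyx _ hp]
  rw [← hlim]
  let h : ℕ → ℝ → ℝ := fun n s => min (|L| * ‖xn n s - y s‖) (2 * M)
  have hh0 : ∀ n s, 0 ≤ h n s := fun n s => le_min (by positivity) (by positivity)
  have hhm : ∀ n, Measurable (h n) := fun n =>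
    ((((hxn n).sub hy.measurable).norm).const_mul _).min measurable_const
  have hhb : ∀ n s, ‖h n s‖ ≤ 2 * M := fun n s => by
    rw [Real.norm_eq_abs, abs_of_nonneg (hh0 n s)]; exact min_le_right _ _
  have hhint : Tendsto (fun n => ∫ s, h n s ∂μ) atTop (nhds 0) := by
    have := tendsto_integral_of_dominated_convergence (μ := μ) (F := h) (f := fun _ => (0 : ℝ))
      (fun _ => 2 * M) (fun n => (hhm n).aestronglyMeasurable) (integrable_const _)
      (fun n => Eventually.of_forall (hhb n)) (by
        have hae' := Measure.ae_smul_measure hae (ENNReal.ofReal t)⁻¹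
        filter_upwards [hae', hμIcc] with s hs hs'
        have h1 : Tendsto (fun n => xn n s - y s) atTop (nhds 0) := by
          rw [hyx s hs']
          simpa using hs.sub_const (x s)
        have h2 : Tendsto (fun n => |L| * ‖xn n s - y s‖) atTop (nhds 0) := by
          simpa using h1.norm.const_mul |L|
        exact squeeze_zero (fun n => hh0 n s) (fun n => min_le_left _ _) h2)
    simpa using this
  have hFint : ∀ n, Integrable
      (fun p : ℝ × U => Real.exp (-α * p.1) * c (xn n p.1, p.2)) (ν n) := fun n => by
    refine Integrable.of_bound (C := M) ?_ ?_
    · refine Measurable.aestronglyMeasurable ?_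
      have := hc.measurable.comp
        (((hxn n).comp measurable_fst).prodMk (measurable_snd (α := ℝ) (β := U)))
      exact (by fun_prop : Measurable fun p : ℝ × U => Real.exp (-α * p.1)).mul this
    · filter_upwards [hνIcc n] with p hp
      rw [Real.norm_eq_abs, abs_mul]
      calc _ ≤ 1 * M := mul_le_mul (hexp _ hp.1) (hM _) (abs_nonneg _) zero_le_one
        _ = M := one_mul M
  have hdiff : ∀ n, ‖∫ p : ℝ × U, Real.exp (-α * p.1) * c (xn n p.1, p.2) ∂(ν n)
      - ∫ p, g p ∂(ν n)‖ ≤ ∫ s, h n s ∂μ := fun n => by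
    rw [← integral_sub (hFint n) (g.integrable _), ← hmarg n,
      integral_map measurable_fst.aemeasurable (hhm n).aestronglyMeasurable]
    apply norm_integral_le_of_norm_le
    · exact Integrable.of_bound (C := 2 * M)
        ((hhm n).comp measurable_fst).aestronglyMeasurable
        (Eventually.of_forall fun p => hhb n p.1)
    · filter_upwards [hνIcc n] with p hp
      rw [hg, max_eq_right hp.1, ← mul_sub, Real.norm_eq_abs, abs_mul]
      have h1 : |c (xn n p.1, p.2) - c (y p.1, p.2)| ≤ h n p.1 := by
        refine le_min ((hL _ _ _).trans ?_) ?_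
        · exact mul_le_mul_of_nonneg_right (le_abs_self L) (norm_nonneg _)
        · have a := abs_le.mp (hM (xn n p.1, p.2))
          have b := abs_le.mp (hM (y p.1, p.2))
          exact abs_le.mpr ⟨by linarith, by linarith⟩
      calc _ ≤ 1 * h n p.1 := mul_le_mul (hexp _ hp.1) h1 (abs_nonneg _) zero_le_one
        _ = h n p.1 := one_mul _
  have hd0 := squeeze_zero_norm hdiff hhint
  simpa using hd0.add (hweak g)
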